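/- For every integer n ≥ 7, the number of words of length n over the alphabet {1,2,3} with no two adjacent letters equal that are superpatterns for [3]^3 equals 6·(2^{n−2} − (n−2)^2). -/

import Mathlib

/-- A word `w` of length `n` over the alphabet `{1,…,d}` (modeled as `Fin d`)
contains the pattern `p` of length `k` if some subsequence of `w` is
order-isomorphic to `p`. -/
def Contains {n k d : ℕ} (w : Fin n → Fin d) (p : Fin k → Fin d) : Prop :=
  ∃ f : Fin k → Fin n, StrictMono f ∧ ∀ a b : Fin k, w (f a) ≤ w (f b) ↔ p a ≤ p b

/-- A word over a ternary alphabet is a superpattern for `[3]^3` if it contains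
every pattern of length 3 over the ternary alphabet. -/
def Superpattern3 {n : ℕ} (w : Fin n → Fin 3) : Prop :=
  ∀ p : Fin 3 → Fin 3, Contains w p

/-- A word is minimal if no two adjacent letters are equal. -/
def MinimalWord {n : ℕ} (w : Fin n → Fin 3) : Prop :=
  ∀ (i : ℕ) (h : i + 1 < n), w ⟨i, Nat.lt_of_succ_lt h⟩ ≠ w ⟨i + 1, h⟩

/-- The words of length `k` over a ternary alphabet without equal adjacent letters which do not
start with the letter `l`. -/
def wordsAfter : ℕ → Fin 3 → List (List (Fin 3))
  | 0, _ => [[]]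
  | k + 1, l =>
    (wordsAfter k (l + 1)).map (List.cons (l + 1)) ++ (wordsAfter k (l + 2)).map (List.cons (l + 2))

theorem mem_wordsAfter {k : ℕ} {l : Fin 3} {w : List (Fin 3)} :
    w ∈ wordsAfter k l ↔ w.length = k ∧ (l :: w).IsChain (· ≠ ·) := by
  induction k generalizing l w with
  | zero => cases w <;> simp [wordsAfter]
  | succ k ih =>
    cases w with
    | nil => simp [wordsAfter]
    | cons a w =>
      have key : ∀ l a : Fin 3, l ≠ a ↔ l + 1 = a ∨ l + 2 = a := by decide
      simp only [wordsAfter, List.mem_append, List.mem_map, List.cons.injEq, List.length_cons,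
        List.isChain_cons_cons, key l a, ih, Nat.add_right_cancel_iff]
      constructor
      · rintro (⟨w, h, rfl, rfl⟩ | ⟨w, h, rfl, rfl⟩) <;> simp [h]
      · rintro ⟨h, rfl | rfl, h'⟩ <;> simp [h, h']

theorem nodup_wordsAfter (k : ℕ) (l : Fin 3) : (wordsAfter k l).Nodup := by
  induction k generalizing l with
  | zero => simp [wordsAfter]
  | succ k ih =>
    refine List.Nodup.append ((ih _).map List.cons_injective) ((ih _).map List.cons_injective) ?_
    intro w h₁ h₂
    simp only [List.mem_map] at h₁ h₂
    obtain ⟨w₁, -, rfl⟩ := h₁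
    obtain ⟨w₂, -, h⟩ := h₂
    exact absurd (List.cons.inj h).1 (by clear * -; revert l; decide)

theorem length_wordsAfter (k : ℕ) (l : Fin 3) : (wordsAfter k l).length = 2 ^ k := by
  induction k generalizing l with
  | zero => simp [wordsAfter]
  | succ k ih => simp [wordsAfter, ih, pow_succ, mul_two]

/-- The number of words in `wordsAfter k l` which do not contain all of the words in `R` as
subsequences. -/
def missCount (R : List (List (Fin 3))) (l : Fin 3) (k : ℕ) : ℕ :=
  (wordsAfter k l).countP fun w => ¬ ∀ p ∈ R, p.Sublist w

/-- What remains to be found of the subsequence `p` once the letter `a` has been read. -/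
def afterReading (a : Fin 3) : List (Fin 3) → List (Fin 3)
  | [] => []
  | b :: p => if b = a then p else b :: p

theorem sublist_cons_iff_afterReading (a : Fin 3) (p w : List (Fin 3)) :
    p.Sublist (a :: w) ↔ (afterReading a p).Sublist w := by
  cases p with
  | nil => simp [afterReading]
  | cons b p =>
    by_cases h : b = a
    · simp [afterReading, h]
    · simp [afterReading, h, List.sublist_cons_iff]

/-- Every word of `R` is a subsequence of a word of `S`. -/
def Dominated (R S : List (List (Fin 3))) : Prop := ∀ p ∈ R, ∃ q ∈ S, p.Sublist q

instance (R S : List (List (Fin 3))) : Decidable (Dominated R S) :=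
  inferInstanceAs (Decidable (∀ p ∈ R, ∃ q ∈ S, p.Sublist q))

theorem countP_cons_eq_missCount {R S : List (List (Fin 3))} {a : Fin 3}
    (h : Dominated (R.map (afterReading a)) S ∧ Dominated S (R.map (afterReading a))) (k : ℕ) :
    (wordsAfter k a).countP (fun w => ¬ ∀ p ∈ R, p.Sublist (a :: w)) = missCount S a k := by
  refine List.countP_congr fun w _ => ?_
  simp only [decide_eq_true_eq, not_iff_not, sublist_cons_iff_afterReading]
  constructor
  · intro hw p hp
    obtain ⟨q, hq, hpq⟩ := h.2 p hp
    obtain ⟨r, hr, rfl⟩ := List.mem_map.1 hq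
    exact hpq.trans (hw r hr)
  · intro hw p hp
    obtain ⟨q, hq, hpq⟩ := h.1 _ (List.mem_map_of_mem hp)
    exact hpq.trans (hw q hq)

theorem missCount_succ {R S T : List (List (Fin 3))} {a b c : Fin 3} (h : [a, b, c].Nodup)
    (hS : Dominated (R.map (afterReading b)) S ∧ Dominated S (R.map (afterReading b)))
    (hT : Dominated (R.map (afterReading c)) T ∧ Dominated T (R.map (afterReading c))) (k : ℕ) :
    missCount R a (k + 1) = missCount S b k + missCount T c k := by
  have key : ∀ a b c : Fin 3, [a, b, c].Nodup →
      (a + 1 = b ∧ a + 2 = c) ∨ (a + 1 = c ∧ a + 2 = b) := by decide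
  rw [← countP_cons_eq_missCount hS, ← countP_cons_eq_missCount hT, missCount, wordsAfter,
    List.countP_append, List.countP_map, List.countP_map]
  obtain ⟨rfl, rfl⟩ | ⟨rfl, rfl⟩ := key a b c h
  · rfl
  · exact Nat.add_comm _ _

theorem missCount_nil (l : Fin 3) (k : ℕ) : missCount [[]] l k = 0 := by
  simp [missCount]

section

variable {a b c : Fin 3}

theorem missCount_b (h : [a, b, c].Nodup) (k : ℕ) : missCount [[b]] a k = 1 := by
  induction k generalizing a b c with
  | zero => revert a b c; decide
  | succ k ih =>
    have step : missCount [[b]] a (k + 1) = missCount [[]] b k + missCount [[b]] c k :=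
      missCount_succ h (by clear * - h; revert a b c; decide)
        (by clear * - h; revert a b c; decide) _
    rw [step, missCount_nil, ih (a := c) (b := b) (c := a) (by grind)]

theorem missCount_ba_bc (h : [a, b, c].Nodup) (k : ℕ) :
    missCount [[b, a]] a k = k + 1 ∧ missCount [[b, c]] a k = k + 1 := by
  induction k generalizing a b c with
  | zero => revert a b c; decide
  | succ k ih =>
    have step₁ : missCount [[b, a]] a (k + 1) = missCount [[a]] b k + missCount [[b, a]] c k :=
      missCount_succ h (by clear * - h; revert a b c; decide)
        (by clear * - h; revert a b c; decide) _
    have step₂ : missCount [[b, c]] a (k + 1) = missCount [[c]] b k + missCount [[b, c]] c k :=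
      missCount_succ h (by clear * - h; revert a b c; decide)
        (by clear * - h; revert a b c; decide) _
    rw [step₁, step₂, (ih (a := c) (b := b) (c := a) (by grind)).1,
      (ih (a := c) (b := b) (c := a) (by grind)).2,
      missCount_b (a := b) (b := a) (c := c) (by grind),
      missCount_b (a := b) (b := c) (c := a) (by grind)]
    omega

theorem missCount_b_c (h : [a, b, c].Nodup) (k : ℕ) : missCount [[b], [c]] a (k + 1) = 2 := by
  have step : missCount [[b], [c]] a (k + 1) = missCount [[c]] b k + missCount [[b]] c k :=
    missCount_succ h (by clear * - h; revert a b c; decide)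
      (by clear * - h; revert a b c; decide) _
  rw [step, missCount_b (a := b) (b := c) (c := a) (by grind),
    missCount_b (a := c) (b := b) (c := a) (by grind)]

theorem missCount_bc_cb (h : [a, b, c].Nodup) (k : ℕ) :
    missCount [[b, c], [c, b]] a (k + 1) = 2 * (k + 1) := by
  have step : missCount [[b, c], [c, b]] a (k + 1) = missCount [[c, b]] b k + missCount [[b, c]] c k :=
    missCount_succ h (by clear * - h; revert a b c; decide)
      (by clear * - h; revert a b c; decide) _
  rw [step, (missCount_ba_bc (a := b) (b := c) (c := a) (by grind) k).1,
    (missCount_ba_bc (a := c) (b := b) (c := a) (by grind) k).1]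
  omega

theorem missCount_ba_bc_pair (h : [a, b, c].Nodup) (k : ℕ) :
    missCount [[b, a], [b, c]] a (k + 1) = 2 * (k + 1) := by
  induction k generalizing a b c with
  | zero => revert a b c; decide
  | succ k ih =>
    have step : missCount [[b, a], [b, c]] a ((k + 1) + 1) = missCount [[a], [c]] b (k + 1) + missCount [[b, c], [b, a]] c (k + 1) :=
      missCount_succ h (by clear * - h; revert a b c; decide)
        (by clear * - h; revert a b c; decide) _
    rw [step, missCount_b_c (a := b) (b := a) (c := c) (by grind),
      ih (a := c) (b := b) (c := a) (by grind)]
    omega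

theorem missCount_b_ca (h : [a, b, c].Nodup) (k : ℕ) :
    missCount [[b], [c, a]] a (k + 2) = k + 4 := by
  have step : missCount [[b], [c, a]] a ((k + 1) + 1) = missCount [[c, a]] b (k + 1) + missCount [[b], [a]] c (k + 1) :=
    missCount_succ h (by clear * - h; revert a b c; decide)
      (by clear * - h; revert a b c; decide) _
  rw [step, (missCount_ba_bc (a := b) (b := c) (c := a) (by grind) (k + 1)).2,
    missCount_b_c (a := c) (b := b) (c := a) (by grind)]

theorem missCount_bac_bca (h : [a, b, c].Nodup) (k : ℕ) :
    missCount [[b, a, c], [b, c, a]] a (k + 1) = k ^ 2 + k + 2 := by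
  induction k generalizing a b c with
  | zero => revert a b c; decide
  | succ k ih =>
    have step : missCount [[b, a, c], [b, c, a]] a ((k + 1) + 1) = missCount [[a, c], [c, a]] b (k + 1) + missCount [[b, c, a], [b, a, c]] c (k + 1) :=
      missCount_succ h (by clear * - h; revert a b c; decide)
        (by clear * - h; revert a b c; decide) _
    rw [step, missCount_bc_cb (a := b) (b := a) (c := c) (by grind),
      ih (a := c) (b := b) (c := a) (by grind)]
    ring

theorem missCount_ba_bc_cb (h : [a, b, c].Nodup) (k : ℕ) :
    missCount [[b, a], [b, c], [c, b]] a (k + 3) = 3 * k + 8 := by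
  have step : missCount [[b, a], [b, c], [c, b]] a ((k + 2) + 1) = missCount [[a], [c, b]] b (k + 2) + missCount [[b, c], [b, a]] c (k + 2) :=
    missCount_succ h (by clear * - h; revert a b c; decide)
      (by clear * - h; revert a b c; decide) _
  rw [step, missCount_b_ca (a := b) (b := a) (c := c) (by grind),
    missCount_ba_bc_pair (a := c) (b := b) (c := a) (by grind) (k + 1)]
  omega

theorem missCount_bac_bca_cb (h : [a, b, c].Nodup) (k : ℕ) :
    missCount [[b, a, c], [b, c, a], [c, b]] a (k + 4) = (k + 4) ^ 2 := by
  have step : missCount [[b, a, c], [b, c, a], [c, b]] a ((k + 3) + 1) = missCount [[c, b], [c, a], [a, c]] b (k + 3) + missCount [[b, c, a], [b, a, c]] c (k + 3) :=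
    missCount_succ h (by clear * - h; revert a b c; decide)
      (by clear * - h; revert a b c; decide) _
  rw [step, missCount_ba_bc_cb (a := b) (b := c) (c := a) (by grind),
    missCount_bac_bca (a := c) (b := b) (c := a) (by grind) (k + 2)]
  ring

theorem missCount_bac_bca_cab_cba (h : [a, b, c].Nodup) (k : ℕ) :
    missCount [[b, a, c], [b, c, a], [c, a, b], [c, b, a]] a (k + 5) = 2 * (k + 4) ^ 2 := by
  have step : missCount [[b, a, c], [b, c, a], [c, a, b], [c, b, a]] a (k + 4 + 1) =
      missCount [[c, b, a], [c, a, b], [a, c]] b (k + 4) +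
        missCount [[b, c, a], [b, a, c], [a, b]] c (k + 4) :=
    missCount_succ h (by clear * - h; revert a b c; decide)
      (by clear * - h; revert a b c; decide) _
  rw [step, missCount_bac_bca_cb (a := b) (b := c) (c := a) (by grind),
    missCount_bac_bca_cb (a := c) (b := b) (c := a) (by grind)]
  ring

end

/-- The six words using each letter exactly once. -/
def permWords : List (List (Fin 3)) :=
  [[0, 1, 2], [0, 2, 1], [1, 0, 2], [1, 2, 0], [2, 0, 1], [2, 1, 0]]

theorem mem_permWords {p : List (Fin 3)} : p ∈ permWords ↔ p.Nodup ∧ p.length = 3 := by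
  constructor
  · revert p; decide
  · rintro ⟨h, h'⟩
    obtain ⟨a, b, c, rfl⟩ := List.length_eq_three.1 h'
    revert a b c; decide

theorem countP_permWords_add (a : Fin 3) (k : ℕ) :
    (wordsAfter (k + 5) a).countP (fun w => ∀ p ∈ permWords, p.Sublist (a :: w)) +
      2 * (k + 4) ^ 2 = 2 ^ (k + 5) := by
  have h : [a, a + 1, a + 2].Nodup := by revert a; decide
  rw [← length_wordsAfter (k + 5) a, ← missCount_bac_bca_cab_cba h,
    List.length_eq_countP_add_countP (fun w => ∀ p ∈ permWords, p.Sublist (a :: w)),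
    ← countP_cons_eq_missCount (R := permWords) (by clear * -; revert a; decide)]
  congr 1
  refine List.countP_congr fun w _ => ?_
  simp

theorem sublist_of_cons_sublist_append_cons {z : Fin 3} {p u v : List (Fin 3)} (hz : z ∉ u)
    (h : (z :: p).Sublist (u ++ z :: v)) : p.Sublist v := by
  induction u with
  | nil => simpa using h
  | cons a u ih => grind

theorem exists_append_cons_of_forall_mem (w : List (Fin 3)) (h : ∀ a, a ∈ w) :
    ∃ x y z u v, [x, y, z].Nodup ∧ w = u ++ z :: v ∧ z ∉ u ∧ x ∈ u ∧ y ∈ u := by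
  induction w using List.reverseRecOn with
  | nil => simp at h
  | append_singleton w a ih =>
    by_cases hw : ∀ b, b ∈ w
    · obtain ⟨x, y, z, u, v, h₁, rfl, h₂⟩ := ih hw
      exact ⟨x, y, z, u, v ++ [a], h₁, by simp, h₂⟩
    · have key : ∀ a : Fin 3, [a + 1, a + 2, a].Nodup := by decide
      have ha := key a
      have h₁ := h (a + 1)
      have h₂ := h (a + 2)
      refine ⟨a + 1, a + 2, a, w, [], ha, rfl, ?_, ?_, ?_⟩
      · simp only [List.mem_append, List.mem_singleton] at h
        grind
      · grind
      · grind

theorem pair_sublist_or {x y : Fin 3} (hxy : x ≠ y) {u : List (Fin 3)} (hx : x ∈ u) (hy : y ∈ u) :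
    [x, y].Sublist u ∨ [y, x].Sublist u := by
  induction u with
  | nil => simp at hx
  | cons a u ih => grind

theorem triple_sublist_or {x y : Fin 3} (hxy : x ≠ y) {v : List (Fin 3)} (h : [x, y].Sublist v)
    (h' : [y, x].Sublist v) : [x, y, x].Sublist v ∨ [y, x, y].Sublist v := by
  induction v with
  | nil => simp at h
  | cons a u ih =>
    by_cases hx : x = a
    · subst hx
      exact .inl (List.cons_sublist_cons.2 (h'.of_cons_of_ne hxy.symm))
    by_cases hy : y = a
    · subst hy
      exact .inr (List.cons_sublist_cons.2 (h.of_cons_of_ne hxy))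
    · exact (ih (h.of_cons_of_ne hx) (h'.of_cons_of_ne hy)).imp (.cons a) (.cons a)

theorem exists_insert_sublist {z : Fin 3} {p v : List (Fin 3)} (hp : p.Sublist v) (hz : z ∈ v)
    (hzp : z ∉ p) : ∃ q r, p = q ++ r ∧ (q ++ z :: r).Sublist v := by
  obtain ⟨s, t, rfl⟩ := List.append_of_mem hz
  obtain ⟨q, r, rfl, hq, hr⟩ := List.sublist_append_iff.1 hp
  refine ⟨q, r, rfl, hq.append (List.cons_sublist_cons.2 ?_)⟩
  grind

/-- Words which contain all patterns of length three that are not permutations, one of which is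
a subsequence of every word containing all permutations. -/
def coreWords (x y z : Fin 3) : List (List (Fin 3)) :=
  [[x, y, x, y, x], [y, x, z, z, x, y, x], [y, x, z, x, z, y, x], [y, x, z, x, y, z, x],
    [y, x, z, x, y, x, z]]

theorem exists_coreWord_sublist_of_triple {x y z : Fin 3} {u v : List (Fin 3)}
    (hd : [x, y, z].Nodup) (hz : z ∉ u) (hx : x ∈ u) (hy : y ∈ u) (hv : [x, y, x].Sublist v)
    (hxyz : [x, y, z].Sublist (u ++ z :: v)) : ∃ L ∈ coreWords x y z, L.Sublist (u ++ z :: v) := by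
  by_cases hu : [x, y].Sublist u
  · exact ⟨_, List.mem_cons_self, hu.append (hv.cons z)⟩
  have hu' : [y, x].Sublist u := (pair_sublist_or (by grind) hx hy).resolve_left hu
  have hzv : z ∈ v := by
    by_contra hzv
    obtain ⟨q, r, hqr, hq, hr⟩ := List.sublist_append_iff.1 hxyz
    have hzq : z ∉ q := fun h => hz (hq.subset h)
    rcases q with _ | ⟨a, _ | ⟨b, _ | ⟨c, q⟩⟩⟩ <;> grind
  obtain ⟨q, r, hqr, h⟩ := exists_insert_sublist hv hzv (by grind)
  refine ⟨[y, x] ++ z :: (q ++ z :: r), ?_, hu'.append (h.cons_cons z)⟩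
  rcases q with _ | ⟨a, _ | ⟨b, _ | ⟨c, q⟩⟩⟩ <;> clear * - hqr <;>
    simp at hqr <;> grind [coreWords]

theorem exists_coreWord_sublist {w : List (Fin 3)} (h : ∀ p ∈ permWords, p.Sublist w) :
    ∃ x y z, [x, y, z].Nodup ∧ ∃ L ∈ coreWords x y z, L.Sublist w := by
  have hw : ∀ a, a ∈ w := fun a =>
    (h [a, a + 1, a + 2] (by revert a; decide)).subset List.mem_cons_self
  obtain ⟨x, y, z, u, v, hd, rfl, hz, hx, hy⟩ := exists_append_cons_of_forall_mem w hw
  have hxy := sublist_of_cons_sublist_append_cons hz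
    (h [z, x, y] (mem_permWords.2 ⟨by grind, rfl⟩))
  have hyx := sublist_of_cons_sublist_append_cons hz
    (h [z, y, x] (mem_permWords.2 ⟨by grind, rfl⟩))
  obtain hv | hv := triple_sublist_or (by grind) hxy hyx
  · exact ⟨x, y, z, hd, exists_coreWord_sublist_of_triple hd hz hx hy hv
      (h _ (mem_permWords.2 ⟨hd, rfl⟩))⟩
  · have hd' : [y, x, z].Nodup := by grind
    exact ⟨y, x, z, hd', exists_coreWord_sublist_of_triple hd' hz hy hx hv
      (h _ (mem_permWords.2 ⟨hd', rfl⟩))⟩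

/-- Two words of length three whose letters compare in the same way. -/
def SameOrder (q p : Fin 3 → Fin 3) : Prop := ∀ a b, q a ≤ q b ↔ p a ≤ p b

instance (q p : Fin 3 → Fin 3) : Decidable (SameOrder q p) :=
  inferInstanceAs (Decidable (∀ a b, q a ≤ q b ↔ p a ≤ p b))

theorem contains_iff_exists_sublist {n k d : ℕ} (w : Fin n → Fin d) (p : Fin k → Fin d) :
    Contains w p ↔ ∃ q : Fin k → Fin d, (∀ a b, q a ≤ q b ↔ p a ≤ p b) ∧
      (List.ofFn q).Sublist (List.ofFn w) := by
  have hk : ∀ q : Fin k → Fin d, (List.ofFn q).length = k := fun _ => List.length_ofFn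
  have hn : (List.ofFn w).length = n := List.length_ofFn
  constructor
  · rintro ⟨f, hf, h⟩
    refine ⟨w ∘ f, h, List.sublist_iff_exists_fin_orderEmbedding_get_eq.2 ?_⟩
    refine ⟨(Fin.castOrderIso (hk _)).toOrderEmbedding.trans
      ((OrderEmbedding.ofStrictMono f hf).trans (Fin.castOrderIso hn.symm).toOrderEmbedding), ?_⟩
    intro i
    simp [Fin.cast]
  · rintro ⟨q, hq, h⟩
    obtain ⟨f, hf⟩ := List.sublist_iff_exists_fin_orderEmbedding_get_eq.1 h
    let g := (Fin.castOrderIso (hk q).symm).toOrderEmbedding.trans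
      (f.trans (Fin.castOrderIso hn).toOrderEmbedding)
    refine ⟨g, OrderEmbedding.strictMono g, ?_⟩
    have hg : ∀ i, w (g i) = q i := by
      intro i
      have hi := hf (Fin.cast (hk q).symm i)
      simp only [List.get_ofFn] at hi
      exact hi.symm
    simpa only [hg] using hq

theorem eq_of_sameOrder_of_injective :
    ∀ q p : Fin 3 → Fin 3, p.Injective → SameOrder q p → q = p := by
  decide

theorem exists_sameOrder_sublist_coreWord : ∀ x y z : Fin 3, [x, y, z].Nodup →
    ∀ L ∈ coreWords x y z, ∀ p : Fin 3 → Fin 3, ¬ p.Injective →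
      ∃ q, SameOrder q p ∧ (List.ofFn q).Sublist L := by
  decide

theorem superpattern3_iff {n : ℕ} (w : Fin n → Fin 3) :
    Superpattern3 w ↔ ∀ p ∈ permWords, p.Sublist (List.ofFn w) := by
  simp only [Superpattern3, contains_iff_exists_sublist]
  constructor
  · intro h p hp
    obtain ⟨hp, hl⟩ := mem_permWords.1 hp
    obtain ⟨a, b, c, rfl⟩ := List.length_eq_three.1 hl
    obtain ⟨q, hq, hqw⟩ := h ![a, b, c]
    rw [eq_of_sameOrder_of_injective q _ (List.nodup_ofFn.1 (by simpa using hp)) hq] at hqw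
    simpa using hqw
  · intro h p
    by_cases hp : p.Injective
    · exact ⟨p, fun _ _ => Iff.rfl, h _ (mem_permWords.2 ⟨List.nodup_ofFn.2 hp, by simp⟩)⟩
    · obtain ⟨x, y, z, hd, L, hL, hLw⟩ := exists_coreWord_sublist h
      obtain ⟨q, hq, hqL⟩ := exists_sameOrder_sublist_coreWord x y z hd L hL p hp
      exact ⟨q, hq, hqL.trans hLw⟩

theorem minimalWord_iff_isChain {n : ℕ} (w : Fin n → Fin 3) :
    MinimalWord w ↔ (List.ofFn w).IsChain (· ≠ ·) := by
  simp [MinimalWord, List.isChain_iff_getElem]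

/-- All words of length `k + 1` without equal adjacent letters. -/
def minimalWords (k : ℕ) : List (List (Fin 3)) :=
  (List.finRange 3).flatMap fun a => (wordsAfter k a).map (List.cons a)

theorem mem_minimalWords {k : ℕ} {w : List (Fin 3)} :
    w ∈ minimalWords k ↔ w.length = k + 1 ∧ w.IsChain (· ≠ ·) := by
  cases w <;> simp [minimalWords, mem_wordsAfter]

theorem nodup_minimalWords (k : ℕ) : (minimalWords k).Nodup := by
  refine List.nodup_flatMap.2 ⟨fun a _ => (nodup_wordsAfter k a).map List.cons_injective, ?_⟩
  refine (List.nodup_finRange 3).imp fun {a b} hab w h₁ h₂ => ?_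
  simp only [List.mem_map] at h₁ h₂
  grind

theorem card_minimal_superpatterns (k : ℕ) :
    Nat.card {w : Fin (k + 1) → Fin 3 // MinimalWord w ∧ Superpattern3 w} =
      (minimalWords k).countP fun w => ∀ p ∈ permWords, p.Sublist w := by
  rw [List.countP_eq_length_filter,
    ← List.toFinset_card_of_nodup ((nodup_minimalWords k).filter _), ← Nat.card_eq_finsetCard]
  have mem_iff : ∀ w : Fin (k + 1) → Fin 3,
      List.ofFn w ∈ ((minimalWords k).filter fun w => ∀ p ∈ permWords, p.Sublist w).toFinset ↔
        MinimalWord w ∧ Superpattern3 w := by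
    intro w
    rw [superpattern3_iff, minimalWord_iff_isChain]
    simp [mem_minimalWords]
  refine Nat.card_eq_of_bijective (fun w => ⟨List.ofFn w.1, (mem_iff w.1).2 w.2⟩) ⟨?_, ?_⟩
  · intro w w' h
    exact Subtype.ext (List.ofFn_injective (Subtype.ext_iff.1 h))
  · rintro ⟨w, hw⟩
    have hl : w.length = k + 1 := by
      simp only [List.mem_toFinset, List.mem_filter, mem_minimalWords] at hw
      exact hw.1.1
    have hw' : List.ofFn (fun i : Fin (k + 1) => w.get (i.cast hl.symm)) = w :=
      List.ext_getElem (by rw [List.length_ofFn, hl]) fun i _ _ => by rw [List.getElem_ofFn]; rfl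
    exact ⟨⟨_, (mem_iff _).1 (hw'.symm ▸ hw)⟩, Subtype.ext hw'⟩

/-- For `n ≥ 7`, the number of minimal superpatterns of length `n` for `[3]^3`
equals `6·(2^(n-2) − (n-2)²)`. -/
theorem minimal_superpattern_count (n : ℕ) (hn : 7 ≤ n) :
    Nat.card {w : Fin n → Fin 3 // MinimalWord w ∧ Superpattern3 w} =
      6 * (2 ^ (n - 2) - (n - 2) ^ 2) := by
  obtain ⟨k, rfl⟩ : ∃ k, n = k + 5 + 1 := ⟨n - 6, by omega⟩
  rw [card_minimal_superpatterns, minimalWords]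
  have h₀ := countP_permWords_add 0 k
  have h₁ := countP_permWords_add 1 k
  have h₂ := countP_permWords_add 2 k
  have e : (2 : ℕ) ^ (k + 5) = 2 * 2 ^ (k + 4) := by ring
  simp only [List.countP_flatMap, List.finRange]
  simp [Function.comp_def]
  omega
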